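/- Let 1 < γ < 3 and λ < 0. Suppose the initial data (τ₀,u₀) ∈ C¹(ℝ) satisfy ‖u₀‖_{C¹} ≤ C₀, ‖τ₀‖_{C¹} ≤ C₀ and C₀⁻¹ < τ₀(x) for all x, for some constant C₀ > 0, and let (τ,u) be a C¹ solution of the system on ℝ × [0,∞). Then ‖u‖_{L∞} is uniformly bounded for all time, and there exists a constant C > 0 depending only on C₀, γ, K, λ and α such that the density ρ = τ⁻¹ satisfies ρ(x,t) ≥ C(1 + t·e^{−λ(1+t)^{1−λ}/(1−λ)})^{4/(γ−3)} for all (x,t) ∈ ℝ × [0,∞); in particular, vacuum never occurs in finite time. -/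

import Mathlib

open Real Set MeasureTheory

/-- Partial derivative in the space variable `x`. -/
noncomputable def pdx (f : ℝ → ℝ → ℝ) (x t : ℝ) : ℝ := deriv (fun y => f y t) x

/-- Partial derivative in the time variable `t`. -/
noncomputable def pdt (f : ℝ → ℝ → ℝ) (x t : ℝ) : ℝ := deriv (fun s => f x s) t

/-- `(τ, u)` is a `C¹` solution of the compressible Euler equations with
time-dependent damping `τ_t - u_x = 0`, `u_t + p_x = -(α/(1+t)^λ) u`,
`p = K τ^{-γ}`, on `ℝ × [0,∞)`. -/
def IsSol (K γ α lam : ℝ) (τ u : ℝ → ℝ → ℝ) : Prop :=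
  ContDiff ℝ 1 (fun p : ℝ × ℝ => τ p.1 p.2) ∧
  ContDiff ℝ 1 (fun p : ℝ × ℝ => u p.1 p.2) ∧
  (∀ x t, 0 ≤ t → 0 < τ x t) ∧
  (∀ x t, 0 ≤ t → pdt τ x t = pdx u x t) ∧
  (∀ x t, 0 ≤ t →
    pdt u x t + pdx (fun y s => K * τ y s ^ (-γ)) x t = -(α / (1 + t) ^ lam) * u x t)

/-- `φ = (2√(Kγ)/(γ-1)) τ^{-(γ-1)/2}`. -/
noncomputable def Phi (K γ : ℝ) (τ : ℝ → ℝ → ℝ) (x t : ℝ) : ℝ :=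
  (2 * Real.sqrt (K * γ) / (γ - 1)) * τ x t ^ (-(γ - 1) / 2)

/-- `K_τ = (2√(Kγ)/(γ-1))^{2/(γ-1)}`. -/
noncomputable def Ktau (K γ : ℝ) : ℝ := (2 * Real.sqrt (K * γ) / (γ - 1)) ^ (2 / (γ - 1))

/-- `K_c = √(Kγ) K_τ^{-(γ+1)/2}`. -/
noncomputable def Kc (K γ : ℝ) : ℝ := Real.sqrt (K * γ) * Ktau K γ ^ (-(γ + 1) / 2)

/-- Blow-up of `‖(τ_x, u_x)‖_{L^∞}` in finite time. -/
def BlowsUp (τ u : ℝ → ℝ → ℝ) : Prop :=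
  ∃ T > (0 : ℝ),
    ¬ BddAbove {r : ℝ | ∃ x t, 0 ≤ t ∧ t ≤ T ∧ r = |pdx τ x t| + |pdx u x t|}

section Calculus

open Filter Topology

/-- The backward cone of slope `M` with apex `(x₀, T)`, cut at time `0`. -/
def backwardCone (x₀ T M : ℝ) : Set (ℝ × ℝ) :=
  {p | 0 ≤ p.2 ∧ p.2 ≤ T ∧ |p.1 - x₀| ≤ M * (T - p.2)}

theorem isCompact_backwardCone (x₀ T : ℝ) {M : ℝ} (hM : 0 ≤ M) :
    IsCompact (backwardCone x₀ T M) := by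
  have hclosed : IsClosed (backwardCone x₀ T M) := by
    refine IsClosed.and ?_ (IsClosed.and ?_ ?_) <;> exact isClosed_le (by fun_prop) (by fun_prop)
  refine ((isCompact_Icc (a := x₀ - M * T) (b := x₀ + M * T)).prod
    (isCompact_Icc (a := 0) (b := T))).of_isClosed_subset hclosed ?_
  rintro ⟨x, t⟩ ⟨h0, hT, hx⟩
  simp only at h0 hT hx
  have := abs_le.1 hx
  have := mul_nonneg hM h0
  exact ⟨⟨by linarith, by linarith⟩, h0, hT⟩

/-- A maximum principle for finitely many functions on a backward cone: if all are negative
initially and each one decreases strictly along some admissible direction whenever it touches `0`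
from below, then all stay negative. -/
theorem neg_of_touching_decreasing {ι : Type*} [Finite ι] {F : ι → ℝ → ℝ → ℝ} {x₀ T M : ℝ}
    (hM : 0 ≤ M)
    (hcont : ∀ i, ContinuousOn (fun p : ℝ × ℝ => F i p.1 p.2) {p | 0 ≤ p.2})
    (hinit : ∀ i x, (x, 0) ∈ backwardCone x₀ T M → F i x 0 < 0)
    (htouch : ∀ i x t, (x, t) ∈ backwardCone x₀ T M → 0 < t → (∀ j, F j x t ≤ 0) →
      F i x t = 0 →
      ∃ v d : ℝ, |v| ≤ M ∧ d < 0 ∧ HasDerivAt (fun s => F i (x + v * s) (t + s)) d 0)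
    (i : ι) {x t : ℝ} (hp : (x, t) ∈ backwardCone x₀ T M) : F i x t < 0 := by
  by_contra! hbad
  set Ω := backwardCone x₀ T M
  have hΩ : Ω ⊆ {p | 0 ≤ p.2} := fun p hp => hp.1
  have hcompact : IsCompact (⋃ j, {p ∈ Ω | 0 ≤ F j p.1 p.2}) := by
    refine isCompact_iUnion fun j => ?_
    have hK := isCompact_backwardCone x₀ T hM
    refine hK.of_isClosed_subset ?_ (fun p hp => hp.1)
    exact ((hcont j).mono hΩ).preimage_isClosed_of_isClosed hK.isClosed isClosed_Ici
  obtain ⟨⟨x', t'⟩, hmem, hmin⟩ := hcompact.exists_isMinOn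
    ⟨(x, t), mem_iUnion.2 ⟨i, hp, hbad⟩⟩ (continuous_snd.continuousOn)
  obtain ⟨j, hq, hj⟩ := mem_iUnion.1 hmem
  simp only at hj
  have hbefore : ∀ k y s, (y, s) ∈ Ω → s < t' → F k y s < 0 := by
    intro k y s hys hs
    by_contra! hk
    exact absurd (hmin (mem_iUnion.2 ⟨k, hys, hk⟩)) (not_le.2 hs)
  have ht' : 0 < t' := by
    rcases hq.1.eq_or_lt with h | h
    · simp only at h
      subst h
      exact absurd hj (not_le.2 (hinit j x' hq))
    · exact h
  have hline : ∀ v, |v| ≤ M → ∀ᶠ s in 𝓝[<] (0 : ℝ), (x' + v * s, t' + s) ∈ Ω ∧ t' + s < t' := by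
    intro v hv
    have : Ioo (-t') 0 ∈ 𝓝[<] (0 : ℝ) := Ioo_mem_nhdsLT (by linarith)
    filter_upwards [this] with s hs
    obtain ⟨-, h2, h3⟩ := hq
    simp only at h2 h3
    refine ⟨⟨by simp only; linarith [hs.1], by simp only; linarith [hs.2], ?_⟩, by linarith [hs.2]⟩
    simp only
    calc |x' + v * s - x₀| = |(x' - x₀) + v * s| := by ring_nf
      _ ≤ |x' - x₀| + |v| * |s| := (abs_add_le _ _).trans_eq (by rw [abs_mul])
      _ ≤ M * (T - t') + M * (-s) := by
        rw [abs_of_neg hs.2]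
        gcongr
        linarith [hs.2]
      _ = M * (T - (t' + s)) := by ring
  have hle : ∀ k, F k x' t' ≤ 0 := by
    intro k
    have hc : Tendsto (fun s => F k (x' + 0 * s) (t' + s)) (𝓝[<] (0 : ℝ)) (𝓝 (F k x' t')) := by
      have h1 : Tendsto (fun s : ℝ => (x' + 0 * s, t' + s)) (𝓝[<] 0)
          (𝓝[{p : ℝ × ℝ | 0 ≤ p.2}] (x', t')) := by
        refine tendsto_nhdsWithin_iff.2 ⟨?_, ?_⟩
        · have : Continuous (fun s : ℝ => (x' + 0 * s, t' + s)) := by fun_prop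
          simpa using (this.tendsto 0).mono_left nhdsWithin_le_nhds
        · filter_upwards [hline 0 (by simpa using hM)] with s hs
          exact hΩ hs.1
      exact (hcont k (x', t') hq.1).tendsto.comp h1
    refine le_of_tendsto hc ?_
    filter_upwards [hline 0 (by simpa using hM)] with s hs
    exact (hbefore k _ _ hs.1 hs.2).le
  have hzero : F j x' t' = 0 := le_antisymm (hle j) hj
  obtain ⟨v, d, hv, hd, hder⟩ := htouch j x' t' hq ht' hle hzero
  have hslope := (hasDerivAt_iff_tendsto_slope.1 hder).mono_left
    (nhdsWithin_mono (0 : ℝ) (show Iio (0 : ℝ) ⊆ {0}ᶜ from fun y hy => ne_of_lt hy))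
  refine absurd (ge_of_tendsto hslope ?_) (not_le.2 hd)
  filter_upwards [hline v hv, self_mem_nhdsWithin] with s hs hs0
  have hneg := hbefore j _ _ hs.1 hs.2
  rw [slope_def_field]
  simp only [mul_zero, add_zero, hzero, sub_zero]
  exact div_nonneg_of_nonpos hneg.le (le_of_lt hs0)

/-- The difference quotient of a `C¹` function extends continuously to step size zero. -/
theorem exists_continuous_diffQuot {f f' : ℝ → ℝ → ℝ}
    (hf : ∀ x t, 0 ≤ t → HasDerivAt (fun y => f y t) (f' x t) x)
    (hf' : ContinuousOn (fun p : ℝ × ℝ => f' p.1 p.2) {p | 0 ≤ p.2}) :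
    ∃ D : ℝ × ℝ × ℝ → ℝ, Continuous D ∧ (∀ x t, 0 ≤ t → D (0, x, t) = f' x t) ∧
      ∀ h x t, 0 ≤ t → h * D (h, x, t) = f (x + h) t - f x t := by
  have hext : Continuous (fun p : ℝ × ℝ => f' p.1 (max p.2 0)) :=
    hf'.comp_continuous (f := fun p : ℝ × ℝ => (p.1, max p.2 0)) (by fun_prop)
      (fun p => le_max_right p.2 0)
  refine ⟨fun q => ∫ θ in (0 : ℝ)..1, f' (q.2.1 + q.1 * θ) (max q.2.2 0), ?_, ?_, ?_⟩
  · refine intervalIntegral.continuous_parametric_intervalIntegral_of_continuous' ?_ 0 1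
    exact hext.comp (g := fun p : ℝ × ℝ => f' p.1 (max p.2 0))
      (f := fun r : (ℝ × ℝ × ℝ) × ℝ => (r.1.2.1 + r.1.1 * r.2, r.1.2.2)) (by fun_prop)
  · intro x t ht
    simp [max_eq_left ht]
  · intro h x t ht
    simp only [max_eq_left ht]
    have hc : Continuous (fun y => f' y t) := by
      have := hext.comp (f := fun y : ℝ => (y, t)) (by fun_prop)
      simpa [Function.comp_def, max_eq_left ht] using this
    rw [← smul_eq_mul, intervalIntegral.smul_integral_comp_add_mul (fun y => f' y t)]
    rw [intervalIntegral.integral_eq_sub_of_hasDerivAt (fun y _ => hf y t ht)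
      (hc.intervalIntegrable _ _)]
    simp

theorem eventually_forall_abs_lt_of_eq_zero {Ω : Set (ℝ × ℝ)} (hΩ : IsCompact Ω)
    {E : ℝ × ℝ × ℝ → ℝ} (hE : ContinuousOn E (univ ×ˢ Ω)) (hE0 : ∀ p ∈ Ω, E (0, p) = 0)
    {δ : ℝ} (hδ : 0 < δ) : ∀ᶠ h in 𝓝[>] (0 : ℝ), ∀ p ∈ Ω, |E (h, p)| < δ := by
  have huc := ((isCompact_Icc (a := (0 : ℝ)) (b := 1)).prod hΩ).uniformContinuousOn_of_continuous
    (hE.mono (prod_mono (subset_univ _) le_rfl))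
  obtain ⟨r, hr, hrE⟩ := Metric.uniformContinuousOn_iff.1 huc δ hδ
  filter_upwards [Ioo_mem_nhdsGT (lt_min hr one_pos)] with h hh p hp
  have h1 := hh.2.trans_le (min_le_left _ _)
  have h2 := hh.2.trans_le (min_le_right _ _)
  have := hrE (h, p) ⟨⟨hh.1.le, h2.le⟩, hp⟩ (0, p) ⟨⟨le_rfl, zero_le_one⟩, hp⟩
    (by simpa [Prod.dist_eq, abs_of_pos hh.1] using ⟨h1, hr⟩)
  simpa [Real.dist_eq, hE0 p hp] using this

variable {f : ℝ → ℝ → ℝ}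

theorem hasDerivAt_pdx (hf : ContDiff ℝ 1 (fun p : ℝ × ℝ => f p.1 p.2)) (x t : ℝ) :
    HasDerivAt (fun y => f y t) (pdx f x t) x := by
  have hd : Differentiable ℝ (fun y : ℝ => f y t) :=
    (hf.differentiable one_ne_zero).comp (g := fun p : ℝ × ℝ => f p.1 p.2)
      (f := fun y : ℝ => (y, t)) (by fun_prop)
  exact (hd x).hasDerivAt

theorem pdx_eq_fderiv (hf : ContDiff ℝ 1 (fun p : ℝ × ℝ => f p.1 p.2)) (x t : ℝ) :
    pdx f x t = fderiv ℝ (fun p : ℝ × ℝ => f p.1 p.2) (x, t) (1, 0) := by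
  have h1 := (hf.differentiable one_ne_zero (x, t)).hasFDerivAt
  have h2 : HasDerivAt (fun y : ℝ => (y, t)) ((1 : ℝ), (0 : ℝ)) x :=
    (hasDerivAt_id x).prodMk (hasDerivAt_const x t)
  exact (h1.comp_hasDerivAt x h2).deriv

theorem pdt_eq_fderiv (hf : ContDiff ℝ 1 (fun p : ℝ × ℝ => f p.1 p.2)) (x t : ℝ) :
    pdt f x t = fderiv ℝ (fun p : ℝ × ℝ => f p.1 p.2) (x, t) (0, 1) := by
  have h1 := (hf.differentiable one_ne_zero (x, t)).hasFDerivAt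
  have h2 : HasDerivAt (fun s : ℝ => (x, s)) ((0 : ℝ), (1 : ℝ)) t :=
    (hasDerivAt_const t x).prodMk (hasDerivAt_id t)
  exact (h1.comp_hasDerivAt t h2).deriv

theorem continuous_pdx (hf : ContDiff ℝ 1 (fun p : ℝ × ℝ => f p.1 p.2)) :
    Continuous (fun p : ℝ × ℝ => pdx f p.1 p.2) := by
  simp only [pdx_eq_fderiv hf]
  exact (hf.continuous_fderiv one_ne_zero).clm_apply continuous_const

theorem hasDerivAt_along_line (hf : ContDiff ℝ 1 (fun p : ℝ × ℝ => f p.1 p.2)) (x t v : ℝ) :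
    HasDerivAt (fun s => f (x + v * s) (t + s)) (v * pdx f x t + pdt f x t) 0 := by
  have h2 : HasDerivAt (fun s : ℝ => (x + v * s, t + s)) (v, (1 : ℝ)) 0 := by
    refine HasDerivAt.prodMk ?_ ((hasDerivAt_id (0 : ℝ)).const_add t)
    simpa using ((hasDerivAt_id (0 : ℝ)).const_mul v).const_add x
  have h1 : HasFDerivAt (fun p : ℝ × ℝ => f p.1 p.2)
      (fderiv ℝ (fun p : ℝ × ℝ => f p.1 p.2) (x, t)) (x + v * 0, t + 0) := by
    simpa using (hf.differentiable one_ne_zero (x, t)).hasFDerivAt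
  refine (h1.comp_hasDerivAt 0 h2).congr_deriv ?_
  rw [pdx_eq_fderiv hf, pdt_eq_fderiv hf, ← smul_eq_mul, ← map_smul, ← map_add]
  simp

end Calculus

/-- `σ`, `φ` and `g` are the square root of the sound speed, the sound-speed potential and the
primitive of `σ`, as functions of the specific volume; `σ'` is the derivative of `σ`. -/
structure IsGasLaw (σ σ' φ g : ℝ → ℝ) : Prop where
  pos : ∀ y, 0 < y → 0 < σ y
  hasDerivAt : ∀ y, 0 < y → HasDerivAt σ (σ' y) y
  deriv_nonpos : ∀ y, 0 < y → σ' y ≤ 0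
  continuousOn_deriv : ContinuousOn σ' (Ioi 0)
  potential_pos : ∀ y, 0 < y → 0 < φ y
  hasDerivAt_potential : ∀ y, 0 < y → HasDerivAt φ (-σ y ^ 2) y
  hasDerivAt_primitive : ∀ y, 0 < y → HasDerivAt g (σ y) y
  bounded : ∀ M, ∃ S, ∀ y, 0 < y → φ y ≤ M → σ y ≤ S

/-- A `C¹` solution of the damped `p`-system with sound speed `σ ^ 2` and damping rate `μ`. -/
structure IsDampedFlow (σ μ : ℝ → ℝ) (τ u : ℝ → ℝ → ℝ) : Prop where
  contDiff_volume : ContDiff ℝ 1 (fun p : ℝ × ℝ => τ p.1 p.2)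
  contDiff_velocity : ContDiff ℝ 1 (fun p : ℝ × ℝ => u p.1 p.2)
  pos : ∀ x t, 0 ≤ t → 0 < τ x t
  mass : ∀ x t, 0 ≤ t → pdt τ x t = pdx u x t
  momentum : ∀ x t, 0 ≤ t → pdt u x t = σ (τ x t) ^ 4 * pdx τ x t - μ t * u x t

/-- The sign attached to a characteristic family. -/
def familySign (e : Bool) : ℝ := if e then 1 else -1

@[simp] theorem familySign_sq (e : Bool) : familySign e ^ 2 = 1 := by
  cases e <;> simp [familySign]

@[simp] theorem abs_familySign (e : Bool) : |familySign e| = 1 := by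
  cases e <;> simp [familySign]

@[simp] theorem familySign_not (e : Bool) : familySign (!e) = -familySign e := by
  cases e <;> simp [familySign]

/-- The space derivative of the Riemann invariant `u ± φ(τ)`, where `φ' = -σ ^ 2`. -/
noncomputable def riemannSlope (σ : ℝ → ℝ) (τ u : ℝ → ℝ → ℝ) (e : Bool) (x t : ℝ) : ℝ :=
  pdx u x t - familySign e * σ (τ x t) ^ 2 * pdx τ x t

namespace IsDampedFlow

open Filter Topology

variable {σ σ' φ g μ μ' : ℝ → ℝ} {τ u : ℝ → ℝ → ℝ}

theorem continuousOn_comp_volume (hs : IsDampedFlow σ μ τ u) {k : ℝ → ℝ}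
    (hk : ContinuousOn k (Ioi 0)) :
    ContinuousOn (fun p : ℝ × ℝ => k (τ p.1 p.2)) {p | 0 ≤ p.2} :=
  hk.comp (f := fun p : ℝ × ℝ => τ p.1 p.2) hs.contDiff_volume.continuous.continuousOn
    (fun p hp => hs.pos p.1 p.2 hp)

theorem hasDerivAt_comp_volume (hs : IsDampedFlow σ μ τ u) {k : ℝ → ℝ} {k' x t : ℝ}
    (v : ℝ) (ht : 0 ≤ t) (hk : HasDerivAt k k' (τ x t)) :
    HasDerivAt (fun s => k (τ (x + v * s) (t + s))) (k' * (v * pdx τ x t + pdx u x t)) 0 := by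
  have h := hasDerivAt_along_line hs.contDiff_volume x t v
  rw [hs.mass x t ht] at h
  refine HasDerivAt.comp (h₂ := k) 0 ?_ h
  simpa using hk

theorem hasDerivAt_velocity (hs : IsDampedFlow σ μ τ u) {x t : ℝ} (v : ℝ) (ht : 0 ≤ t) :
    HasDerivAt (fun s => u (x + v * s) (t + s))
      (v * pdx u x t + (σ (τ x t) ^ 4 * pdx τ x t - μ t * u x t)) 0 := by
  rw [← hs.momentum x t ht]
  exact hasDerivAt_along_line hs.contDiff_velocity x t v

/-- The Riemann invariants obey a maximum principle. -/
theorem potential_add_abs_velocity_le (hs : IsDampedFlow σ μ τ u) (hg : IsGasLaw σ σ' φ g)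
    (hμ : ∀ t, 0 ≤ t → 0 ≤ μ t) {m : ℝ} (h0 : ∀ x, φ (τ x 0) + |u x 0| ≤ m) (x t : ℝ)
    (ht : 0 ≤ t) : φ (τ x t) + |u x t| ≤ m + 1 := by
  obtain ⟨S, hS⟩ := hg.bounded (m + 1)
  set bar : ℝ → ℝ := fun s => m + (1 + s) / (1 + t)
  have hT : 0 < 1 + t := by linarith
  have hbar : ∀ s, s ≤ t → bar s ≤ m + 1 := fun s hst => by
    have : (1 + s) / (1 + t) ≤ 1 := (div_le_one hT).2 (by linarith)
    simp only [bar]; linarith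
  have key : ∀ e : Bool, φ (τ x t) + familySign e * u x t - bar t < 0 := by
    intro e
    refine neg_of_touching_decreasing (x₀ := x) (T := t) (M := S ^ 2)
      (F := fun e x t => φ (τ x t) + familySign e * u x t - bar t) (sq_nonneg S)
      ?_ ?_ ?_ e ⟨ht, le_rfl, by simp⟩
    · intro e
      have h1 := hs.continuousOn_comp_volume (k := φ)
        (fun y hy => (hg.hasDerivAt_potential y hy).continuousAt.continuousWithinAt)
      have h2 := hs.contDiff_velocity.continuous.continuousOn (s := {p : ℝ × ℝ | 0 ≤ p.2})
      have h3 : Continuous bar := by fun_prop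
      exact (h1.add (continuousOn_const.mul h2)).sub (h3.comp continuous_snd).continuousOn
    · intro e y _
      have h1 : familySign e * u y 0 ≤ |u y 0| := by
        simpa [abs_mul] using le_abs_self (familySign e * u y 0)
      have h2 : 0 < (1 + 0) / (1 + t) := by positivity
      simp only [bar]
      linarith [h0 y]
    · intro e y s hys hspos hle hzero
      have hτ := hs.pos y s hspos.le
      have hplus := hle true
      have hminus := hle false
      simp only [familySign, if_true, Bool.false_eq_true, if_false] at hplus hminus
      have hσ : σ (τ y s) ≤ S := hS _ hτ (by linarith [hbar s hys.2.1])
      have hσ0 := hg.pos _ hτ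
      refine ⟨familySign e * σ (τ y s) ^ 2, -μ s * (familySign e * u y s) - 1 / (1 + t),
        ?_, ?_, ?_⟩
      · rw [abs_mul, abs_familySign, one_mul, abs_of_pos (by positivity)]
        gcongr
      · have h1 : 0 ≤ familySign e * u y s := by
          cases e <;> simp only [familySign, if_true, Bool.false_eq_true, if_false] at hzero ⊢ <;>
            linarith
        have h2 := mul_nonneg (hμ s hspos.le) h1
        have h3 : 0 < 1 / (1 + t) := by positivity
        linarith
      · have hb : HasDerivAt (fun r => bar (s + r)) (1 / (1 + t)) 0 :=
          ((((hasDerivAt_id (0 : ℝ)).const_add s).const_add 1).div_const (1 + t)).const_add m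
        refine (((hs.hasDerivAt_comp_volume (familySign e * σ (τ y s) ^ 2) hspos.le
          (hg.hasDerivAt_potential _ hτ)).add ((hs.hasDerivAt_velocity
          (familySign e * σ (τ y s) ^ 2) hspos.le).const_mul (familySign e))).sub hb).congr_deriv ?_
        linear_combination (σ (τ y s) ^ 2 * pdx u y s) * familySign_sq e
  have hp := key true
  have hm := key false
  simp only [familySign, if_true, Bool.false_eq_true, if_false] at hp hm
  have := hbar t le_rfl
  rcases abs_cases (u x t) with ⟨h, _⟩ | ⟨h, _⟩ <;> rw [h] <;> linarith

theorem hasDerivAt_riemann (hs : IsDampedFlow σ μ τ u) (hg : IsGasLaw σ σ' φ g) (e : Bool)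
    {x t : ℝ} (v : ℝ) (ht : 0 ≤ t) :
    HasDerivAt (fun s => u (x + v * s) (t + s) + familySign e * φ (τ (x + v * s) (t + s)))
      ((v - familySign e * σ (τ x t) ^ 2) * riemannSlope σ τ u e x t - μ t * u x t) 0 := by
  refine ((hs.hasDerivAt_velocity v ht).add ((hs.hasDerivAt_comp_volume v ht
    (hg.hasDerivAt_potential _ (hs.pos x t ht))).const_mul (familySign e))).congr_deriv ?_
  rw [riemannSlope]
  linear_combination (-σ (τ x t) ^ 4 * pdx τ x t) * familySign_sq e

theorem continuousOn_riemannSlope (hs : IsDampedFlow σ μ τ u) (hg : IsGasLaw σ σ' φ g)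
    (e : Bool) : ContinuousOn (fun p : ℝ × ℝ => riemannSlope σ τ u e p.1 p.2) {p | 0 ≤ p.2} := by
  have h1 := hs.continuousOn_comp_volume (k := σ)
    (fun y hy => (hg.hasDerivAt y hy).continuousAt.continuousWithinAt)
  exact (continuous_pdx hs.contDiff_velocity).continuousOn.sub
    ((continuousOn_const.mul (h1.pow 2)).mul (continuous_pdx hs.contDiff_volume).continuousOn)

/-- The difference quotient of a Riemann invariant with step `h`. -/
noncomputable def _root_.riemannQuot (φ : ℝ → ℝ) (τ u : ℝ → ℝ → ℝ) (e : Bool) (h x t : ℝ) : ℝ :=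
  ((u (x + h) t + familySign e * φ (τ (x + h) t)) - (u x t + familySign e * φ (τ x t))) / h

/-- Along its own characteristic direction, the weighted difference quotient
`σ F + μ g / 2` of a Riemann invariant satisfies a Riccati equation up to a uniformly small error
as the step tends to zero. -/
theorem eventually_riccati (hs : IsDampedFlow σ μ τ u) (hg : IsGasLaw σ σ' φ g)
    (hμc : ContinuousOn μ (Ici 0)) (hμ' : ∀ t, 0 < t → HasDerivAt μ (μ' t) t)
    {Ω : Set (ℝ × ℝ)} (hΩ : IsCompact Ω) (hΩ0 : ∀ p ∈ Ω, 0 ≤ p.2) {δ : ℝ} (hδ : 0 < δ)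
    (e : Bool) : ∀ᶠ h in 𝓝[>] (0 : ℝ), ∀ x t, (x, t) ∈ Ω →
      |σ (τ x t) * (riemannQuot φ τ u e h x t - riemannSlope σ τ u e x t)| < δ ∧
      (0 < t → ∃ E, |E| < δ ∧ HasDerivAt
        (fun s => σ (τ (x + familySign e * σ (τ x t) ^ 2 * s) (t + s)) *
            riemannQuot φ τ u e h (x + familySign e * σ (τ x t) ^ 2 * s) (t + s) +
          μ (t + s) * g (τ (x + familySign e * σ (τ x t) ^ 2 * s) (t + s)) / 2)
        (σ' (τ x t) * riemannSlope σ τ u e x t ^ 2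
          - μ t * (σ (τ x t) * riemannSlope σ τ u e x t) / 2 + μ' t * g (τ x t) / 2 + E) 0) := by
  have hσc := hs.continuousOn_comp_volume (k := σ)
    (fun y hy => (hg.hasDerivAt y hy).continuousAt.continuousWithinAt)
  have hσ'c := hs.continuousOn_comp_volume hg.continuousOn_deriv
  have hac := hs.continuousOn_riemannSlope hg
  have hderiv_comp : ∀ {k : ℝ → ℝ} {k' x t : ℝ}, HasDerivAt k k' (τ x t) →
      HasDerivAt (fun y => k (τ y t)) (k' * pdx τ x t) x := fun {k k' x t} hk =>
    HasDerivAt.comp (h := fun y => τ y t) x hk (hasDerivAt_pdx hs.contDiff_volume x t)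
  obtain ⟨DF, hDFc, hDF0, hDF⟩ := exists_continuous_diffQuot
    (f := fun x t => u x t + familySign e * φ (τ x t)) (f' := riemannSlope σ τ u e)
    (fun x t ht => ((hasDerivAt_pdx hs.contDiff_velocity x t).add ((hderiv_comp
      (hg.hasDerivAt_potential _ (hs.pos x t ht))).const_mul (familySign e))).congr_deriv
        (by rw [riemannSlope]; ring)) (hac e)
  obtain ⟨Du, hDuc, hDu0, hDu⟩ := exists_continuous_diffQuot (f := u) (f' := pdx u)
    (fun x t _ => hasDerivAt_pdx hs.contDiff_velocity x t)
    (continuous_pdx hs.contDiff_velocity).continuousOn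
  obtain ⟨Dc, hDcc, hDc0, hDc⟩ := exists_continuous_diffQuot
    (f := fun x t => σ (τ x t) ^ 2)
    (f' := fun x t => 2 * σ (τ x t) * (σ' (τ x t) * pdx τ x t))
    (fun x t ht => ((hderiv_comp (hg.hasDerivAt _ (hs.pos x t ht))).pow 2).congr_deriv
      (by ring))
    ((continuousOn_const.mul hσc).mul
      (hσ'c.mul (continuous_pdx hs.contDiff_volume).continuousOn))
  set a := riemannSlope σ τ u e with ha
  set b := riemannSlope σ τ u (!e) with hb
  set E₁ : ℝ × ℝ × ℝ → ℝ := fun q =>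
    σ (τ q.2.1 q.2.2) * (DF q - a q.2.1 q.2.2) with hE₁
  set E₂ : ℝ × ℝ × ℝ → ℝ := fun q =>
    σ' (τ q.2.1 q.2.2) * b q.2.1 q.2.2 * (DF q - a q.2.1 q.2.2)
      - σ (τ q.2.1 q.2.2) * μ q.2.2 * (Du q - pdx u q.2.1 q.2.2)
      - familySign e * σ (τ q.2.1 q.2.2) * (Dc q * a (q.2.1 + q.1) q.2.2
        - 2 * σ (τ q.2.1 q.2.2) * (σ' (τ q.2.1 q.2.2) * pdx τ q.2.1 q.2.2) * a q.2.1 q.2.2)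
    with hE₂
  have lift : ∀ {k : ℝ × ℝ → ℝ}, ContinuousOn k {p | 0 ≤ p.2} →
      ContinuousOn (fun q : ℝ × ℝ × ℝ => k q.2) (univ ×ˢ Ω) := fun hk =>
    hk.comp continuous_snd.continuousOn (fun q hq => hΩ0 q.2 hq.2)
  have hσl := lift hσc
  have hσ'l := lift hσ'c
  have hal := lift (hac e)
  have hbl := lift (hac (!e))
  have huxl := lift (continuous_pdx hs.contDiff_velocity).continuousOn
  have hτxl := lift (continuous_pdx hs.contDiff_volume).continuousOn
  have hμl : ContinuousOn (fun q : ℝ × ℝ × ℝ => μ q.2.2) (univ ×ˢ Ω) :=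
    lift (k := fun p => μ p.2) (hμc.comp continuous_snd.continuousOn (fun p hp => hp))
  have hasl : ContinuousOn (fun q : ℝ × ℝ × ℝ => a (q.2.1 + q.1) q.2.2) (univ ×ˢ Ω) :=
    (hac e).comp (f := fun q : ℝ × ℝ × ℝ => (q.2.1 + q.1, q.2.2)) (by fun_prop)
      (fun q hq => hΩ0 q.2 hq.2)
  have hE₁c : ContinuousOn E₁ (univ ×ˢ Ω) := hσl.mul (hDFc.continuousOn.sub hal)
  have hE₂c : ContinuousOn E₂ (univ ×ˢ Ω) :=
    (((hσ'l.mul hbl).mul (hDFc.continuousOn.sub hal)).sub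
      ((hσl.mul hμl).mul (hDuc.continuousOn.sub huxl))).sub
      ((continuousOn_const.mul hσl).mul ((hDcc.continuousOn.mul hasl).sub
        (((continuousOn_const.mul hσl).mul (hσ'l.mul hτxl)).mul hal)))
  have hE₁0 : ∀ p ∈ Ω, E₁ (0, p) = 0 := fun p hp => by
    simp [hE₁, hDF0 p.1 p.2 (hΩ0 p hp)]
  have hE₂0 : ∀ p ∈ Ω, E₂ (0, p) = 0 := fun p hp => by
    simp [hE₂, hDF0 p.1 p.2 (hΩ0 p hp), hDu0 p.1 p.2 (hΩ0 p hp), hDc0 p.1 p.2 (hΩ0 p hp)]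
  filter_upwards [eventually_forall_abs_lt_of_eq_zero hΩ hE₁c hE₁0 hδ,
    eventually_forall_abs_lt_of_eq_zero hΩ hE₂c hE₂0 hδ, self_mem_nhdsWithin]
    with h h₁ h₂ (hpos : 0 < h) x t hxt
  have ht : 0 ≤ t := hΩ0 _ hxt
  have hquot : riemannQuot φ τ u e h x t = DF (h, x, t) := by
    rw [riemannQuot, ← hDF h x t ht]
    field_simp
  refine ⟨by rw [hquot]; exact h₁ _ hxt, fun htpos => ⟨_, h₂ _ hxt, ?_⟩⟩
  set v := familySign e * σ (τ x t) ^ 2 with hv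
  have hshift := hs.hasDerivAt_riemann hg e (x := x + h) v ht
  have hF : HasDerivAt (fun s => riemannQuot φ τ u e h (x + v * s) (t + s))
      (-μ t * Du (h, x, t) - familySign e * Dc (h, x, t) * a (x + h) t) 0 := by
    have h4 := (hshift.sub (hs.hasDerivAt_riemann hg e (x := x) v ht)).div_const h
    refine (h4.congr_deriv ?_).congr_of_eventuallyEq (Eventually.of_forall fun s => ?_)
    · rw [div_eq_iff hpos.ne']
      linear_combination μ t * hDu h x t ht + familySign e * a (x + h) t * hDc h x t ht
    · simp only [riemannQuot, Pi.sub_apply, add_right_comm x (v * s) h]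
  have hslope : v * pdx τ x t + pdx u x t = b x t := by
    rw [hb, riemannSlope, familySign_not]; ring
  have hσd := hs.hasDerivAt_comp_volume v ht (hg.hasDerivAt _ (hs.pos x t ht))
  have hgd := hs.hasDerivAt_comp_volume v ht (hg.hasDerivAt_primitive _ (hs.pos x t ht))
  have hμd : HasDerivAt (fun s => μ (t + s)) (μ' t) 0 := by
    have := (hμ' t htpos)
    rw [← add_zero t] at this
    simpa using this.comp_const_add t 0
  rw [hslope] at hσd hgd
  refine ((hσd.mul hF).add ((hμd.mul hgd).div_const 2)).congr_deriv ?_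
  have hux : pdx u x t = (a x t + b x t) / 2 := by
    rw [ha, hb, riemannSlope, riemannSlope, familySign_not]; ring
  have hτx : 2 * familySign e * σ (τ x t) ^ 2 * pdx τ x t = b x t - a x t := by
    rw [ha, hb, riemannSlope, riemannSlope, familySign_not]; ring
  simp only [hE₂, mul_zero, add_zero, hquot, hux]
  linear_combination (-σ' (τ x t) * a x t) * hτx

/-- The primitive `g(τ)` of the square root of the sound speed grows at most linearly in time. -/
theorem primitive_le (hs : IsDampedFlow σ μ τ u) (hg : IsGasLaw σ σ' φ g)
    (hμc : ContinuousOn μ (Ici 0)) (hμ : ∀ t, 0 ≤ t → 0 ≤ μ t)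
    (hμ' : ∀ t, 0 < t → HasDerivAt μ (μ' t) t) (hμ'0 : ∀ t, 0 < t → 0 ≤ μ' t)
    {m A B : ℝ} (h0 : ∀ x, φ (τ x 0) + |u x 0| ≤ m) (hA : ∀ x, g (τ x 0) < A)
    (hB0 : 0 ≤ B) (hB : ∀ e x, σ (τ x 0) * riemannSlope σ τ u e x 0 ≤ B) (x t : ℝ)
    (ht : 0 ≤ t) : g (τ x t) ≤ A + 2 * (B + 1) * t := by
  obtain ⟨S, hS⟩ := hg.bounded (m + 1)
  have hσS : ∀ y s, 0 ≤ s → σ (τ y s) ≤ S := fun y s hs0 => hS _ (hs.pos y s hs0) <| by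
    have := hs.potential_add_abs_velocity_le hg hμ h0 y s hs0
    linarith [abs_nonneg (u y s)]
  have hcompact := isCompact_backwardCone x t (sq_nonneg S)
  set η : ℝ := 1 / (2 * (t + 1)) with hη
  have hη0 : 0 < η := by positivity
  have hηt : ∀ s, s ≤ t → η * s ≤ 1 / 2 := fun s hst => by
    rw [hη, div_mul_eq_mul_div, div_le_div_iff₀ (by positivity) (by positivity)]
    linarith
  have hη1 : η ≤ 1 / 2 := by
    rw [hη]
    exact one_div_le_one_div_of_le (by norm_num) (by linarith)
  have hev := fun e => hs.eventually_riccati hg hμc hμ' hcompact (fun p hp => hp.1)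
    (half_pos hη0) e
  obtain ⟨h, hric⟩ := (eventually_all.2 hev).exists
  set G : ℝ → ℝ := fun s => A + 2 * (B + 1) * s with hG
  set F : Option Bool → ℝ → ℝ → ℝ := fun i y s => i.elim (g (τ y s) - G s) fun e =>
    σ (τ y s) * riemannQuot φ τ u e h y s + μ s * g (τ y s) / 2
      - (B + 1 + η * s + μ s * G s / 2) with hF
  have hGd : ∀ s, HasDerivAt (fun r => G (s + r)) (2 * (B + 1)) 0 := fun s =>
    ((((hasDerivAt_id (0 : ℝ)).const_add s).const_mul (2 * (B + 1))).const_add A).congr_deriv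
      (by ring)
  have hGc : Continuous G := by fun_prop
  have hmain : F none x t < 0 := by
    refine neg_of_touching_decreasing (x₀ := x) (T := t) (M := S ^ 2) (sq_nonneg S)
      ?_ ?_ ?_ none ⟨ht, le_rfl, by simp⟩
    · have hgc := hs.continuousOn_comp_volume (k := g)
        (fun y hy => (hg.hasDerivAt_primitive y hy).continuousAt.continuousWithinAt)
      have hσc := hs.continuousOn_comp_volume (k := σ)
        (fun y hy => (hg.hasDerivAt y hy).continuousAt.continuousWithinAt)
      have hφc := hs.continuousOn_comp_volume (k := φ)
        (fun y hy => (hg.hasDerivAt_potential y hy).continuousAt.continuousWithinAt)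
      have hμc' : ContinuousOn (fun p : ℝ × ℝ => μ p.2) {p | 0 ≤ p.2} :=
        hμc.comp continuous_snd.continuousOn (fun p hp => hp)
      have hGc' : ContinuousOn (fun p : ℝ × ℝ => G p.2) {p | 0 ≤ p.2} :=
        (hGc.comp continuous_snd).continuousOn
      rintro (_ | e)
      · exact hgc.sub hGc'
      · have hsc := hs.contDiff_velocity.continuous.continuousOn.add
          ((continuousOn_const (c := familySign e)).mul hφc)
        have hqc : ContinuousOn (fun p : ℝ × ℝ => riemannQuot φ τ u e h p.1 p.2)
            {p | 0 ≤ p.2} :=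
          ((hsc.comp (f := fun p : ℝ × ℝ => (p.1 + h, p.2)) (by fun_prop)
            (fun p hp => hp)).sub hsc).div_const h
        have hηc : ContinuousOn (fun p : ℝ × ℝ => B + 1 + η * p.2) {p | 0 ≤ p.2} := by
          fun_prop
        exact ((hσc.mul hqc).add ((hμc'.mul hgc).div_const 2)).sub
          (hηc.add ((hμc'.mul hGc').div_const 2))
    · rintro (_ | e) y hy
      · simpa [hF, hG] using hA y
      · have h1 := (abs_lt.1 (hric e y 0 hy).1).2
        have h2 := mul_le_mul_of_nonneg_left (hA y).le (hμ 0 le_rfl)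
        simp only [hF, hG, Option.elim_some]
        linarith [hB e y]
    · rintro i y s hys hs0 hle hzero
      have hst : s ≤ t := hys.2.1
      have hσ0 := hg.pos _ (hs.pos y s hs0.le)
      have hμs := hμ s hs0.le
      have hgG : g (τ y s) ≤ G s := by
        have := hle none
        simp only [hF, Option.elim_none] at this
        linarith
      have hμG := mul_le_mul_of_nonneg_left hgG hμs
      have hηs := hηt s hst
      have hηs0 := mul_nonneg hη0.le hs0.le
      rcases i with _ | e
      · refine ⟨0, σ (τ y s) * (0 * pdx τ y s + pdx u y s) - 2 * (B + 1),
          by simpa using sq_nonneg S, ?_, (hs.hasDerivAt_comp_volume 0 hs0.le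
            (hg.hasDerivAt_primitive _ (hs.pos y s hs0.le))).sub (hGd s)⟩
        have hgs : g (τ y s) = G s := by
          simp only [hF, Option.elim_none] at hzero
          linarith
        have hslope : ∀ e, σ (τ y s) * riemannSlope σ τ u e y s < B + 1 + 1 / 2 + η / 2 := by
          intro e
          have h1 := (abs_lt.1 (hric e y s hys).1).1
          have h2 := hle (some e)
          simp only [hF, Option.elim_some, hgs] at h2
          linarith
        have h1 := hslope true
        have h2 := hslope false
        simp only [riemannSlope, familySign, if_true, Bool.false_eq_true, if_false] at h1 h2
        linarith
      · obtain ⟨hclose, hder⟩ := hric e y s hys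
        obtain ⟨E, hE, hd⟩ := hder hs0
        have hμd : HasDerivAt (fun r => μ (s + r)) (μ' s) 0 := by
          have := hμ' s hs0
          rw [← add_zero s] at this
          simpa using this.comp_const_add s 0
        refine ⟨familySign e * σ (τ y s) ^ 2, _, ?_, ?_, hd.sub
          (((((hasDerivAt_id (0 : ℝ)).const_add s).const_mul η).const_add (B + 1)).add
            ((hμd.mul (hGd s)).div_const 2))⟩
        · rw [abs_mul, abs_familySign, one_mul, abs_of_pos (by positivity)]
          gcongr
          exact hσS y s hs0.le
        · have h1 := (abs_lt.1 hclose).2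
          have h2 : 0 ≤ σ (τ y s) * riemannSlope σ τ u e y s := by
            simp only [hF, Option.elim_some] at hzero
            linarith
          have h3 := mul_nonneg hμs h2
          have h4 := mul_le_mul_of_nonneg_left hgG (hμ'0 s hs0)
          have h5 := mul_nonneg (neg_nonneg.2 (hg.deriv_nonpos _ (hs.pos y s hs0.le)))
            (sq_nonneg (riemannSlope σ τ u e y s))
          have h6 := (abs_lt.1 hE).2
          have h7 := mul_nonneg hμs (by linarith : 0 ≤ 2 * (B + 1))
          simp only [add_zero]
          linarith
  simp only [hF, Option.elim_none, hG] at hmain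
  linarith

end IsDampedFlow

theorem isGasLaw_gamma {κ γ : ℝ} (hκ : 0 < κ) (hγ1 : 1 < γ) (hγ3 : γ < 3) :
    IsGasLaw (fun y => κ * y ^ (-(γ + 1) / 4))
      (fun y => κ * (-(γ + 1) / 4 * y ^ (-(γ + 1) / 4 - 1)))
      (fun y => 2 * κ ^ 2 / (γ - 1) * y ^ (-(γ - 1) / 2))
      (fun y => 4 * κ / (3 - γ) * y ^ ((3 - γ) / 4)) where
  pos y hy := by positivity
  hasDerivAt y hy := (Real.hasDerivAt_rpow_const (.inl hy.ne')).const_mul κ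
  deriv_nonpos y hy := by
    have : 0 ≤ κ * ((γ + 1) / 4 * y ^ (-(γ + 1) / 4 - 1)) := by positivity
    linarith
  continuousOn_deriv := continuousOn_const.mul (continuousOn_const.mul
    (continuousOn_id.rpow_const fun y hy => .inl (ne_of_gt hy)))
  potential_pos y hy := by
    have : 0 < γ - 1 := by linarith
    positivity
  hasDerivAt_potential y hy := by
    refine ((Real.hasDerivAt_rpow_const (.inl hy.ne')).const_mul _).congr_deriv ?_
    have h1 : γ - 1 ≠ 0 := by linarith
    rw [mul_pow, ← Real.rpow_mul_natCast hy.le]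
    have h2 : -(γ + 1) / 4 * (2 : ℕ) = -(γ - 1) / 2 - 1 := by push_cast; ring
    rw [h2]
    field_simp
  hasDerivAt_primitive y hy := by
    refine ((Real.hasDerivAt_rpow_const (.inl hy.ne')).const_mul _).congr_deriv ?_
    have h1 : 3 - γ ≠ 0 := by linarith
    have h2 : (3 - γ) / 4 - 1 = -(γ + 1) / 4 := by ring
    rw [h2]
    field_simp
  bounded M := by
    have h1 : 0 < γ - 1 := by linarith
    refine ⟨κ * (M / (2 * κ ^ 2 / (γ - 1))) ^ ((γ + 1) / (2 * (γ - 1))), fun y hy hM => ?_⟩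
    have h2 : -(γ + 1) / 4 = -(γ - 1) / 2 * ((γ + 1) / (2 * (γ - 1))) := by
      field_simp; ring
    rw [h2, Real.rpow_mul hy.le]
    gcongr
    rw [le_div_iff₀ (by positivity)]
    linarith

theorem IsSol.isDampedFlow {K γ α lam κ : ℝ} {τ u : ℝ → ℝ → ℝ} (h : IsSol K γ α lam τ u)
    (hκ : κ ^ 4 = K * γ) :
    IsDampedFlow (fun y => κ * y ^ (-(γ + 1) / 4)) (fun t => α / (1 + t) ^ lam) τ u := by
  obtain ⟨hτ, hu, hpos, hmass, hmom⟩ := h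
  refine ⟨hτ, hu, hpos, hmass, fun x t ht => ?_⟩
  have hy := hpos x t ht
  have hp : pdx (fun y s => K * τ y s ^ (-γ)) x t =
      K * (pdx τ x t * (-γ) * τ x t ^ (-γ - 1)) :=
    (((hasDerivAt_pdx hτ x t).rpow_const (.inl hy.ne')).const_mul K).deriv
  have hm := hmom x t ht
  rw [hp] at hm
  have h2 : -(γ + 1) / 4 * (4 : ℕ) = -γ - 1 := by push_cast; ring
  rw [mul_pow, ← Real.rpow_mul_natCast hy.le, h2, hκ]
  linarith

theorem stmt3 (K γ α lam C₀ : ℝ) (hK : 0 < K) (hγ1 : 1 < γ) (hγ3 : γ < 3)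
    (hα : 0 ≤ α) (hlam : lam < 0) (hC₀ : 0 < C₀) :
    ∃ C > (0 : ℝ),
      ∀ (τ₀ u₀ : ℝ → ℝ), ContDiff ℝ 1 τ₀ → ContDiff ℝ 1 u₀ →
        (∀ x, |u₀ x| ≤ C₀ ∧ |deriv u₀ x| ≤ C₀) →
        (∀ x, |τ₀ x| ≤ C₀ ∧ |deriv τ₀ x| ≤ C₀) →
        (∀ x, C₀⁻¹ < τ₀ x) →
      ∀ (τ u : ℝ → ℝ → ℝ), IsSol K γ α lam τ u →
        (∀ x, τ x 0 = τ₀ x ∧ u x 0 = u₀ x) →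
        (∃ U : ℝ, ∀ x t, 0 ≤ t → |u x t| ≤ U) ∧
        (∀ x t, 0 ≤ t →
          C * (1 + t * Real.exp (-lam * (1 + t) ^ (1 - lam) / (1 - lam)))
              ^ ((4 : ℝ) / (γ - 3)) ≤ (τ x t)⁻¹) := by
  have hKγ : 0 < K * γ := by positivity
  obtain ⟨κ, hκ, hκ4⟩ : ∃ κ : ℝ, 0 < κ ∧ κ ^ 4 = K * γ := by
    refine ⟨(K * γ) ^ ((4 : ℝ)⁻¹), by positivity, ?_⟩
    exact_mod_cast Real.rpow_inv_natCast_pow hKγ.le (n := 4) (by norm_num)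
  have hg := isGasLaw_gamma hκ hγ1 hγ3
  have h3γ : 0 < 3 - γ := by linarith
  have hγ0 : 0 < γ - 1 := by linarith
  have hinv : 0 < C₀⁻¹ := inv_pos.2 hC₀
  set κ₀ : ℝ := 4 * κ / (3 - γ) with hκ₀
  have hκ₀pos : 0 < κ₀ := by positivity
  set S : ℝ := κ * C₀⁻¹ ^ (-(γ + 1) / 4) with hS
  have hS0 : 0 < S := by positivity
  set A : ℝ := κ₀ * C₀ ^ ((3 - γ) / 4) + 1 with hA
  set B : ℝ := S * (C₀ + S ^ 2 * C₀) with hB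
  have hA0 : 0 < A := by positivity
  have hB0 : 0 < B := by positivity
  set L : ℝ := (A + 2 * (B + 1)) / κ₀ with hL
  have hL0 : 0 < L := by positivity
  refine ⟨L ^ ((4 : ℝ) / (γ - 3)), by positivity, ?_⟩
  intro τ₀ u₀ _ _ hu₀ hτ₀ hτ₀pos τ u hsol hinit
  have hs := hsol.isDampedFlow hκ4
  have hτinit : (fun y => τ y 0) = τ₀ := funext fun y => (hinit y).1
  have huinit : (fun y => u y 0) = u₀ := funext fun y => (hinit y).2
  have hτle : ∀ x, τ x 0 ≤ C₀ := fun x => by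
    rw [(hinit x).1]; exact (le_abs_self _).trans (hτ₀ x).1
  have hτge : ∀ x, C₀⁻¹ ≤ τ x 0 := fun x => by
    rw [(hinit x).1]; exact (hτ₀pos x).le
  have hμ : ∀ t : ℝ, 0 ≤ t → 0 ≤ α / (1 + t) ^ lam := fun t ht => by positivity
  have hμd : ∀ t : ℝ, 0 ≤ t →
      HasDerivAt (fun t => α / (1 + t) ^ lam) (α * (-lam * (1 + t) ^ (-lam - 1))) t := by
    intro t ht
    have hd := (((hasDerivAt_id t).const_add 1).rpow_const (p := -lam)
      (.inl (by simp only [id]; positivity))).const_mul α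
    refine (hd.congr_deriv (by simp)).congr_of_eventuallyEq ?_
    filter_upwards [lt_mem_nhds (show -1 < t by linarith)] with s hs
    simp only [id]
    rw [Real.rpow_neg (by linarith), div_eq_mul_inv]
  have hφ0 : ∀ x, 2 * κ ^ 2 / (γ - 1) * τ x 0 ^ (-(γ - 1) / 2) + |u x 0| ≤
      2 * κ ^ 2 / (γ - 1) * C₀⁻¹ ^ (-(γ - 1) / 2) + C₀ := fun x => by
    have h1 := Real.rpow_le_rpow_of_nonpos hinv (hτge x)
      (show -(γ - 1) / 2 ≤ 0 by linarith)
    have h2 : |u x 0| ≤ C₀ := by rw [(hinit x).2]; exact (hu₀ x).1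
    gcongr
  refine ⟨⟨2 * κ ^ 2 / (γ - 1) * C₀⁻¹ ^ (-(γ - 1) / 2) + C₀ + 1, fun x t ht => ?_⟩,
    fun x t ht => ?_⟩
  · have := hs.potential_add_abs_velocity_le hg hμ hφ0 x t ht
    have := hg.potential_pos _ (hs.pos x t ht)
    linarith
  have hτ := hs.pos x t ht
  have hbound := hs.primitive_le hg (fun t ht => (hμd t ht).continuousAt.continuousWithinAt) hμ
    (fun t ht => hμd t ht.le)
    (fun t ht => by have := neg_pos.2 hlam; positivity) hφ0 (A := A) (B := B)
    (fun y => by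
      have h1 := hs.pos y 0 le_rfl
      have : κ₀ * τ y 0 ^ ((3 - γ) / 4) ≤ κ₀ * C₀ ^ ((3 - γ) / 4) := by
        gcongr
        exact hτle y
      linarith)
    hB0.le
    (fun e y => by
      have h1 := hs.pos y 0 le_rfl
      have hσ : κ * τ y 0 ^ (-(γ + 1) / 4) ≤ S :=
        mul_le_mul_of_nonneg_left (Real.rpow_le_rpow_of_nonpos hinv (hτge y) (by linarith)) hκ.le
      have hux : |pdx u y 0| ≤ C₀ := by
        rw [pdx, huinit]; exact (hu₀ y).2
      have hτx : |pdx τ y 0| ≤ C₀ := by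
        rw [pdx, hτinit]; exact (hτ₀ y).2
      have hsq : |familySign e * (κ * τ y 0 ^ (-(γ + 1) / 4)) ^ 2 * pdx τ y 0| ≤ S ^ 2 * C₀ := by
        rw [abs_mul, abs_mul, abs_familySign, one_mul, abs_of_nonneg (by positivity)]
        gcongr
      have hslope : riemannSlope (fun y => κ * y ^ (-(γ + 1) / 4)) τ u e y 0 ≤
          C₀ + S ^ 2 * C₀ := by
        rw [riemannSlope]
        linarith [(abs_le.1 hux).2, (abs_le.1 hsq).1]
      calc _ ≤ κ * τ y 0 ^ (-(γ + 1) / 4) * (C₀ + S ^ 2 * C₀) := by gcongr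
        _ ≤ B := mul_le_mul_of_nonneg_right hσ (by positivity))
    x t ht
  set W : ℝ := 1 + t * Real.exp (-lam * (1 + t) ^ (1 - lam) / (1 - lam)) with hW
  have htW : 1 + t ≤ W := by
    have h1 : 0 < 1 - lam := by linarith
    have h2 : 0 < -lam := by linarith
    have : 1 ≤ Real.exp (-lam * (1 + t) ^ (1 - lam) / (1 - lam)) :=
      Real.one_le_exp (by positivity)
    nlinarith
  have hW0 : 0 < W := by linarith
  have hLW : τ x t ^ ((3 - γ) / 4) ≤ L * W := by
    rw [hL, div_mul_eq_mul_div, le_div_iff₀ hκ₀pos]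
    have h1 : (A + 2 * (B + 1)) * (1 + t) ≤ (A + 2 * (B + 1)) * W := by gcongr
    nlinarith
  have hpow := Real.rpow_le_rpow_of_nonpos (by positivity) hLW
    (show (4 : ℝ) / (γ - 3) ≤ 0 from div_nonpos_of_nonneg_of_nonpos (by norm_num) (by linarith))
  have hexp : (3 - γ) / 4 * (4 / (γ - 3)) = -1 := by
    have : γ - 3 ≠ 0 := by linarith
    field_simp
    ring
  rwa [← Real.rpow_mul hτ.le, hexp, Real.rpow_neg_one, Real.mul_rpow hL0.le hW0.le] at hpow
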